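/- arXiv:2409.07923 — 3 statements merged into one kernel-verified Lean document; each statement's English description precedes it below -/
import Mathlib

section
/- Let k be a field admitting a surjective group homomorphism v : kˣ → ℤ from its unit group onto the additive integers, and let ℓ be a prime number. Then the natural map from kˣ to the inverse limit over i ∈ ℕ of the quotient groups kˣ/(kˣ)^{ℓ^i} (with the natural projection transition maps) is not surjective; that is, there exists a family (a_i)_{i∈ℕ} with a_i ∈ kˣ/(kˣ)^{ℓ^i}, compatible under the projections kˣ/(kˣ)^{ℓ^{i+1}} → kˣ/(kˣ)^{ℓ^i}, such that no single element x ∈ kˣ has residue class a_i in kˣ/(kˣ)^{ℓ^i} for every i. -/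
/-- The subgroup `(kˣ)^m` of `m`-th powers of the unit group of a field `k`. -/
def unitsPowSubgroup (k : Type*) [Field k] (m : ℕ) : Subgroup kˣ :=
  (powMonoidHom m : kˣ →* kˣ).range

lemma unitsPowSubgroup_succ_le (k : Type*) [Field k] (ℓ i : ℕ) :
    unitsPowSubgroup k (ℓ ^ (i + 1)) ≤ unitsPowSubgroup k (ℓ ^ i) := by
  rintro x ⟨y, rfl⟩
  exact ⟨y ^ ℓ, by simp only [powMonoidHom_apply, ← pow_mul, ← pow_succ']⟩

/-- The natural projection `kˣ/(kˣ)^{ℓ^{i+1}} → kˣ/(kˣ)^{ℓ^i}`. -/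
def unitsPowQuotProj (k : Type*) [Field k] (ℓ i : ℕ) :
    kˣ ⧸ unitsPowSubgroup k (ℓ ^ (i + 1)) →* kˣ ⧸ unitsPowSubgroup k (ℓ ^ i) :=
  QuotientGroup.map _ _ (MonoidHom.id kˣ)
    (fun x hx => unitsPowSubgroup_succ_le k ℓ i hx)

/-- An integer divisible by every power of some `ℓ > 1` is zero. -/
lemma Int.eq_zero_of_forall_pow_dvd {ℓ : ℕ} (hℓ : 1 < ℓ) {n : ℤ}
    (h : ∀ i : ℕ, (ℓ : ℤ) ^ i ∣ n) : n = 0 := by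
  refine Int.eq_zero_of_abs_lt_dvd (h n.natAbs) ?_
  rw [Int.abs_eq_natAbs]
  exact_mod_cast Nat.lt_pow_self hℓ

/-- The `ℓ`-adic integer `∑ ℓ ^ (2 * j) = 1 / (1 - ℓ ^ 2)` is not a rational integer. -/
lemma not_forall_pow_dvd_geom_sum_sub {ℓ : ℕ} (hℓ : 1 < ℓ) (n : ℤ) :
    ¬∀ i : ℕ, (ℓ : ℤ) ^ i ∣ (∑ j ∈ Finset.range i, ((ℓ : ℤ) ^ 2) ^ j) - n := by
  intro h
  have hz : n * ((ℓ : ℤ) ^ 2 - 1) + 1 = 0 := by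
    refine Int.eq_zero_of_forall_pow_dvd hℓ fun i => ?_
    have hpow : (ℓ : ℤ) ^ i ∣ ((ℓ : ℤ) ^ 2) ^ i := ⟨(ℓ : ℤ) ^ i, by ring⟩
    have hsum := geom_sum_mul ((ℓ : ℤ) ^ 2) i
    have heq : n * ((ℓ : ℤ) ^ 2 - 1) + 1 = ((ℓ : ℤ) ^ 2) ^ i -
        ((∑ j ∈ Finset.range i, ((ℓ : ℤ) ^ 2) ^ j) - n) * ((ℓ : ℤ) ^ 2 - 1) := by
      linear_combination hsum
    rw [heq]
    exact dvd_sub hpow ((h i).mul_right _)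
  have hdvd : (ℓ : ℤ) ^ 2 - 1 ∣ 1 := ⟨-n, by linear_combination hz⟩
  have hle := Int.le_of_dvd one_pos hdvd
  have hℓ' : (2 : ℤ) ≤ ℓ := by exact_mod_cast hℓ
  nlinarith

/-- If a field `k` admits a surjective homomorphism `v : kˣ → ℤ` (multiplicative to additive)
and `ℓ` is a prime, then the natural map `kˣ → lim_i kˣ/(kˣ)^{ℓ^i}` is not surjective: there
is a compatible family of residue classes admitting no common lift. -/
theorem units_to_invLimit_powQuot_not_surjective (k : Type*) [Field k]
    (v : kˣ → ℤ) (hmul : ∀ x y : kˣ, v (x * y) = v x + v y)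
    (hsurj : Function.Surjective v) (ℓ : ℕ) (hℓ : ℓ.Prime) :
    ∃ a : (i : ℕ) → kˣ ⧸ unitsPowSubgroup k (ℓ ^ i),
      (∀ i : ℕ, unitsPowQuotProj k ℓ i (a (i + 1)) = a i) ∧
      ¬∃ x : kˣ, ∀ i : ℕ,
        (QuotientGroup.mk x : kˣ ⧸ unitsPowSubgroup k (ℓ ^ i)) = a i := by
  obtain ⟨t, ht⟩ := hsurj 1
  let w : kˣ →* Multiplicative ℤ :=
    { toFun := fun x => Multiplicative.ofAdd (v x)
      map_one' := by
        have h := hmul 1 1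
        rw [mul_one] at h
        exact congrArg Multiplicative.ofAdd (by lia : v 1 = 0)
      map_mul' := fun x y => congrArg Multiplicative.ofAdd (hmul x y) }
  have hpow (x : kˣ) (n : ℕ) : v (x ^ n) = n * v x := by
    simpa [w] using congrArg Multiplicative.toAdd (map_pow w x n)
  have hinv (x : kˣ) : v x⁻¹ = -v x := congrArg Multiplicative.toAdd (map_inv w x)
  refine ⟨fun i => QuotientGroup.mk (t ^ ∑ j ∈ Finset.range i, (ℓ ^ 2) ^ j), fun i => ?_, ?_⟩
  · refine QuotientGroup.eq.2 ⟨(t ^ ℓ ^ i)⁻¹, ?_⟩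
    simp only [powMonoidHom_apply, MonoidHom.id_apply, Finset.sum_range_succ, pow_add, mul_inv_rev,
      inv_mul_cancel_right, inv_pow, ← pow_mul]
    ring_nf
  · rintro ⟨x, hx⟩
    refine not_forall_pow_dvd_geom_sum_sub hℓ.one_lt (v x) fun i => ?_
    obtain ⟨y, hy⟩ := QuotientGroup.eq.1 (hx i)
    refine ⟨v y, ?_⟩
    have h := congrArg v hy
    rw [powMonoidHom_apply, hmul, hinv, hpow, hpow, ht] at h
    push_cast at h
    linear_combination -h
end

section
/- Let p be a prime number, Γ a group, and M an abelian group on which Γ acts by additive automorphisms (a distributive action). Assume that every element m ∈ M with p·m = 0 is fixed by every element of Γ, and let b ∈ M be an element such that p·b is fixed by every element of Γ. Then the Γ-orbit of b is a coset b + H for some subgroup H of M all of whose elements are killed by p; in particular, if the orbit of b is finite then its cardinality is a power of p, and if moreover b itself is not fixed by Γ then p divides the cardinality of the orbit of b. -/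
theorem AddSubgroup.exists_card_eq_prime_pow {M : Type*} [AddCommGroup M] {p : ℕ} (hp : p.Prime)
    (H : AddSubgroup M) [Finite H] (hH : ∀ h ∈ H, p • h = 0) : ∃ n : ℕ, Nat.card H = p ^ n := by
  have : Fact p.Prime := ⟨hp⟩
  have hpgroup : IsPGroup p (Multiplicative H) := fun h =>
    ⟨1, by
      rw [pow_one]
      exact congrArg Multiplicative.ofAdd (Subtype.ext (hH _ h.toAdd.2) : p • h.toAdd = 0)⟩
  have : Finite (Multiplicative H) := Finite.of_equiv H Multiplicative.ofAdd
  exact (IsPGroup.iff_card (G := Multiplicative H)).mp hpgroup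

/-- If `Γ` fixes every difference `γ • b - b`, these differences form a subgroup. -/
def displacementSubgroup {Γ M : Type*} [Group Γ] [AddCommGroup M] [DistribMulAction Γ M] (b : M)
    (h : ∀ γ δ : Γ, γ • (δ • b - b) = δ • b - b) : AddSubgroup M where
  carrier := Set.range fun γ : Γ => γ • b - b
  zero_mem' := ⟨1, by simp⟩
  add_mem' := by
    rintro _ _ ⟨γ, rfl⟩ ⟨δ, rfl⟩
    refine ⟨γ * δ, ?_⟩
    have key := h γ δ
    rw [smul_sub, ← mul_smul] at key
    simp only [← key]
    abel
  neg_mem' := by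
    rintro _ ⟨γ, rfl⟩
    refine ⟨γ⁻¹, ?_⟩
    have key := h γ⁻¹ γ
    rw [smul_sub, inv_smul_smul] at key
    simp only [← key]
    abel


/-- Let `Γ` act on an abelian group `M` by additive automorphisms.  If every `p`-torsion
element of `M` is fixed by `Γ` and `b ∈ M` is such that `p • b` is fixed by `Γ`, then the
orbit of `b` is a coset `b + H` of a subgroup `H` killed by `p`; in particular a finite orbit
has cardinality a power of `p`, and if `b` is not fixed then `p` divides the cardinality of
its orbit. -/
theorem orbit_eq_coset_of_pTorsion_fixed (p : ℕ) (hp : p.Prime)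
    (Γ : Type*) [Group Γ] (M : Type*) [AddCommGroup M] [DistribMulAction Γ M]
    (htors : ∀ m : M, p • m = 0 → ∀ γ : Γ, γ • m = m)
    (b : M) (hb : ∀ γ : Γ, γ • (p • b) = p • b) :
    ∃ H : AddSubgroup M, (∀ h ∈ H, p • h = 0) ∧
      MulAction.orbit Γ b = (fun h => b + h) '' (H : Set M) ∧
      ((MulAction.orbit Γ b).Finite → ∃ n : ℕ, Nat.card (MulAction.orbit Γ b) = p ^ n) ∧
      ((MulAction.orbit Γ b).Finite → (¬ ∀ γ : Γ, γ • b = b) →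
        p ∣ Nat.card (MulAction.orbit Γ b)) := by
  have hdiff : ∀ γ : Γ, p • (γ • b - b) = 0 := fun γ => by
    rw [smul_sub, ← smul_comm γ p b, hb, sub_self]
  let H := displacementSubgroup b fun γ δ : Γ => htors _ (hdiff δ) γ
  have hH : ∀ h ∈ H, p • h = 0 := by
    rintro _ ⟨γ, rfl⟩
    exact hdiff γ
  have horbit : MulAction.orbit Γ b = (fun h => b + h) '' (H : Set M) := by
    change Set.range _ = _ '' Set.range _
    rw [← Set.range_comp]
    congr 1
    ext γ
    simp
  have hpow : (MulAction.orbit Γ b).Finite →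
      ∃ n : ℕ, Nat.card (MulAction.orbit Γ b) = p ^ n := fun hfin => by
    rw [horbit] at hfin ⊢
    have : Finite H := (hfin.of_finite_image (add_right_injective b).injOn).to_subtype
    rw [Nat.card_image_of_injective (add_right_injective b)]
    exact H.exists_card_eq_prime_pow hp hH
  refine ⟨H, hH, horbit, hpow, fun hfin hfix => ?_⟩
  obtain ⟨n, hn⟩ := hpow hfin
  rw [hn]
  refine dvd_pow_self p fun hzero => hfix fun γ => ?_
  rw [hzero, pow_zero] at hn
  have := (Nat.card_eq_one_iff_unique.mp hn).1
  exact congrArg Subtype.val (Subsingleton.elim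
    (⟨γ • b, MulAction.mem_orbit b γ⟩ : MulAction.orbit Γ b) ⟨b, MulAction.mem_orbit_self b⟩)
end

section
/- Let k be a field of characteristic 0 and A a commutative Hopf algebra over k whose comultiplication is cocommutative, such that A is reduced (has no nonzero nilpotent elements) and the prime spectrum of A is connected (equivalently, the only idempotents of A are 0 and 1). Then for every positive integer n, the n-th convolution power [n] : A → A of the identity map is an injective map. -/
open TensorProduct

/-- The `n`-th convolution power `[n] : A → A` of the identity map of a Hopf algebra `A`:
`[0] = unit ∘ counit` and `[n+1] = mult ∘ ([n] ⊗ id) ∘ comul`.  For a commutative and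
cocommutative Hopf algebra this is the multiplication-by-`n` map of the corresponding
affine group scheme `Spec A`. -/
noncomputable def convPowId (k A : Type*) [CommSemiring k] [Semiring A] [HopfAlgebra k A] :
    ℕ → (A →ₗ[k] A)
  | 0 => Algebra.linearMap k A ∘ₗ Coalgebra.counit
  | n + 1 => LinearMap.mul' k A ∘ₗ
      TensorProduct.map (convPowId k A n) LinearMap.id ∘ₗ Coalgebra.comul

open WithConv

section Bialgebra

variable {k B : Type*} [CommRing k] [CommRing B] [Bialgebra k B]

theorem Coalgebra.Repr.algHom_convMul_apply {ι : Type*} {A : Type*} [CommRing A] [Algebra k A]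
    {x : B} (r : Coalgebra.Repr k x ι) (f g : WithConv (B →ₐ[k] A)) :
    (f * g) x = ∑ i ∈ r.index, f (r.left i) * g (r.right i) := by
  rw [AlgHom.convMul_apply, ← r.eq, map_sum]
  rfl

/-- Convolution of augmented algebra endomorphisms is additive modulo the square of the
augmentation ideal. -/
theorem convMul_sub_add_mem_sq (f g : WithConv (B →ₐ[k] B))
    (hf : (Bialgebra.counitAlgHom k B).comp f.ofConv = Bialgebra.counitAlgHom k B)
    (hg : (Bialgebra.counitAlgHom k B).comp g.ofConv = Bialgebra.counitAlgHom k B)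
    {x : B} (hx : x ∈ RingHom.ker (Bialgebra.counitAlgHom k B)) :
    (f * g) x - (f x + g x) ∈ RingHom.ker (Bialgebra.counitAlgHom k B) ^ 2 := by
  let r := Coalgebra.Repr.arbitrary k x
  have mem (h : WithConv (B →ₐ[k] B))
      (hh : (Bialgebra.counitAlgHom k B).comp h.ofConv = Bialgebra.counitAlgHom k B) (b : B) :
      h b - (1 : WithConv (B →ₐ[k] B)) b ∈ RingHom.ker (Bialgebra.counitAlgHom k B) := by
    have := DFunLike.congr_fun hh b
    simpa [RingHom.mem_ker, sub_eq_zero] using this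
  have h0 : (1 : WithConv (B →ₐ[k] B)) x = 0 := by
    simp_all [RingHom.mem_ker]
  have key : (f * g) x - (f x + g x) = ∑ i ∈ r.index,
      (f (r.left i) - (1 : WithConv (B →ₐ[k] B)) (r.left i)) *
        (g (r.right i) - (1 : WithConv (B →ₐ[k] B)) (r.right i)) := by
    have e1 := r.algHom_convMul_apply f 1
    have e2 := r.algHom_convMul_apply 1 g
    have e3 := r.algHom_convMul_apply (A := B) 1 1
    simp only [mul_one, one_mul] at e1 e2 e3
    rw [h0] at e3
    simp only [sub_mul, mul_sub, Finset.sum_sub_distrib, ← e1, ← e2, ← e3,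
      ← r.algHom_convMul_apply f g]
    ring
  rw [key, pow_two]
  exact Ideal.sum_mem _ fun i _ ↦ Ideal.mul_mem_mul (mem f hf _) (mem g hg _)

variable (k B) in
/-- The `n`-th convolution power of the identity of a commutative bialgebra, as an algebra
endomorphism. -/
noncomputable def convPowAlgHom (n : ℕ) : B →ₐ[k] B :=
  (toConv (AlgHom.id k B) ^ n).ofConv

theorem counitAlgHom_comp_convPowAlgHom (n : ℕ) :
    (Bialgebra.counitAlgHom k B).comp (convPowAlgHom k B n) = Bialgebra.counitAlgHom k B := by
  induction n with
  | zero => ext x; simp [convPowAlgHom]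
  | succ n ih =>
    rw [convPowAlgHom] at ih
    rw [convPowAlgHom, pow_succ, AlgHom.comp_convMul_distrib, ih]
    exact congrArg ofConv (one_mul (1 : WithConv (B →ₐ[k] k)))

theorem convPowAlgHom_sub_nsmul_mem_sq (n : ℕ) {x : B}
    (hx : x ∈ RingHom.ker (Bialgebra.counitAlgHom k B)) :
    convPowAlgHom k B n x - n * x ∈ RingHom.ker (Bialgebra.counitAlgHom k B) ^ 2 := by
  induction n with
  | zero =>
    have : convPowAlgHom k B 0 x = 0 := by simp_all [convPowAlgHom, RingHom.mem_ker]
    simp [this]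
  | succ n ih =>
    have h := convMul_sub_add_mem_sq (toConv (AlgHom.id k B) ^ n) (toConv (AlgHom.id k B))
      (counitAlgHom_comp_convPowAlgHom n) (AlgHom.comp_id _) hx
    rw [← pow_succ] at h
    convert Ideal.add_mem _ h ih using 1
    change convPowAlgHom k B (n + 1) x - _ =
      convPowAlgHom k B (n + 1) x - (convPowAlgHom k B n x + x) + _
    push_cast
    ring

end Bialgebra

/-- A ring endomorphism acting on `I / I ^ 2` as multiplication by `c` acts on
`I ^ m / I ^ (m + 1)` as multiplication by `c ^ m`. -/
theorem Ideal.map_sub_pow_mul_mem {B : Type*} [CommRing B] (I : Ideal B) (φ : B →+* B) (c : B)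
    (h0 : ∀ x, φ x - x ∈ I) (h1 : ∀ x ∈ I, φ x - c * x ∈ I ^ 2) (m : ℕ) {x : B}
    (hx : x ∈ I ^ m) : φ x - c ^ m * x ∈ I ^ (m + 1) := by
  induction m generalizing x with
  | zero => simpa using h0 x
  | succ m ih =>
    rw [pow_succ] at hx
    induction hx using Submodule.mul_induction_on' with
    | mem_mul_mem a ha b hb =>
      have e : φ (a * b) - c ^ (m + 1) * (a * b) =
          (φ a - c ^ m * a) * φ b + (c ^ m * a) * (φ b - c * b) := by
        rw [map_mul]; ring
      have hb' : φ b ∈ I := by simpa using I.add_mem (h0 b) hb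
      rw [e]
      refine Ideal.add_mem _ ?_ ?_
      · exact pow_succ I (m + 1) ▸ Ideal.mul_mem_mul (ih ha) hb'
      · rw [show m + 1 + 1 = m + 2 from rfl, pow_add]
        exact Ideal.mul_mem_mul (Ideal.mul_mem_left _ _ ha) (h1 b hb)
    | add a _ b _ ha hb =>
      convert Ideal.add_mem _ ha hb using 1
      rw [map_add]; ring

section Field

variable {k B : Type*} [Field k] [CharZero k] [CommRing B] [Bialgebra k B]

theorem ker_convPowAlgHom_le_pow {n : ℕ} (hn : n ≠ 0) (m : ℕ) :
    RingHom.ker (convPowAlgHom k B n) ≤ RingHom.ker (Bialgebra.counitAlgHom k B) ^ m := by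
  intro x hx
  induction m with
  | zero => simp
  | succ m ih =>
    have h := Ideal.map_sub_pow_mul_mem (RingHom.ker (Bialgebra.counitAlgHom k B))
      (convPowAlgHom k B n : B →+* B) n (fun x ↦ by
        have := DFunLike.congr_fun (counitAlgHom_comp_convPowAlgHom (k := k) (B := B) n) x
        simp_all [RingHom.mem_ker]) (fun x hx ↦ convPowAlgHom_sub_nsmul_mem_sq n hx) m ih
    have hx' : convPowAlgHom k B n x = 0 := hx
    have h' : (n : B) ^ m * x ∈ RingHom.ker (Bialgebra.counitAlgHom k B) ^ (m + 1) := by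
      simpa [hx'] using h
    have hu : IsUnit ((n : B) ^ m) := by
      have : (n : B) = algebraMap k B n := by simp
      rw [this]
      exact ((IsUnit.mk0 (n : k) (by exact_mod_cast hn)).map _).pow m
    exact (Ideal.unit_mul_mem_iff_mem _ hu).1 h'

theorem exists_counit_eq_one_forall_mul_eq_zero [IsNoetherianRing B] {n : ℕ} (hn : n ≠ 0) :
    ∃ s : B, Coalgebra.counit (R := k) s = 1 ∧
      ∀ x ∈ RingHom.ker (convPowAlgHom k B n), s * x = 0 := by
  set I := RingHom.ker (Bialgebra.counitAlgHom k B)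
  obtain ⟨r, hr, h⟩ := Submodule.exists_mem_and_smul_eq_self_of_fg_of_le_smul I
    (⨅ i : ℕ, I ^ i • ⊤ : Ideal B) (IsNoetherian.noetherian _) (by
      intro x hx
      obtain ⟨r, hr⟩ := (I.mem_iInf_smul_pow_eq_bot_iff x).1 hx
      rw [← hr]
      exact Submodule.smul_mem_smul r.2 hx)
  have hr' : Coalgebra.counit (R := k) r = 0 := hr
  refine ⟨1 - r, by simp [hr'], fun x hx ↦ ?_⟩
  have := h x (by simpa [Submodule.mem_iInf] using fun i ↦ ker_convPowAlgHom_le_pow hn i hx)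
  rw [smul_eq_mul] at this
  rw [sub_mul, this, one_mul, sub_self]

end Field

section Translation

variable {k A L : Type*} [Field k] [CommRing A] [HopfAlgebra k A] [CommRing L] [Algebra k L]

/-- Translation by the `L`-valued point `χ`, as the algebra homomorphism
`a ↦ χ a₁ ⊗ a₂` from `A` to `L ⊗ A`. -/
noncomputable def translationAlgHom (χ : WithConv (A →ₐ[k] L)) : A →ₐ[k] L ⊗[k] A :=
  (Algebra.TensorProduct.map χ.ofConv (AlgHom.id k A)).comp (Bialgebra.comulAlgHom k A)

theorem toConv_translationAlgHom (χ : WithConv (A →ₐ[k] L)) :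
    toConv (translationAlgHom χ) =
      toConv ((Algebra.TensorProduct.includeLeft : L →ₐ[k] L ⊗[k] A).comp χ.ofConv) *
        toConv (Algebra.TensorProduct.includeRight : A →ₐ[k] L ⊗[k] A) := by
  rw [AlgHom.convMul_def, translationAlgHom, ← AlgHom.comp_assoc]
  congr 2
  ext <;> simp

/-- The inverse of an `L`-valued point. -/
noncomputable def pointInv (χ : WithConv (A →ₐ[k] L)) : WithConv (A →ₐ[k] L) :=
  toConv (χ.ofConv.comp (HopfAlgebra.antipodeAlgHom k A))

theorem pointInv_mul_cancel (χ : WithConv (A →ₐ[k] L)) : pointInv χ * χ = 1 := by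
  have h := AlgHom.comp_convMul_distrib χ.ofConv (toConv (AlgHom.id k A))⁻¹ (toConv (AlgHom.id k A))
  rw [inv_mul_cancel] at h
  refine ofConv_injective (h.symm.trans ?_)
  ext; simp

theorem mul_pointInv_cancel (χ : WithConv (A →ₐ[k] L)) : χ * pointInv χ = 1 := by
  have h := AlgHom.comp_convMul_distrib χ.ofConv (toConv (AlgHom.id k A)) (toConv (AlgHom.id k A))⁻¹
  rw [mul_inv_cancel] at h
  refine ofConv_injective (h.symm.trans ?_)
  ext; simp

/-- The `L`-linear extension of `translationAlgHom` to an endomorphism of `L ⊗ A`. -/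
noncomputable def translationEnd (χ : WithConv (A →ₐ[k] L)) : L ⊗[k] A →ₐ[k] L ⊗[k] A :=
  Algebra.TensorProduct.lift Algebra.TensorProduct.includeLeft (translationAlgHom χ)
    fun _ _ ↦ .all _ _

theorem translationEnd_one_tmul (χ : WithConv (A →ₐ[k] L)) (a : A) :
    translationEnd χ (1 ⊗ₜ a) = translationAlgHom χ a := by
  simp [translationEnd, ← Algebra.TensorProduct.one_def]

theorem translationEnd_inv_translationAlgHom (χ : WithConv (A →ₐ[k] L)) (a : A) :
    translationEnd (pointInv χ) (translationAlgHom χ a) = 1 ⊗ₜ a := by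
  have h1 : (translationEnd (pointInv χ)).comp Algebra.TensorProduct.includeRight =
      translationAlgHom (pointInv χ) := AlgHom.ext (translationEnd_one_tmul _)
  have h2 : (translationEnd (pointInv χ)).comp Algebra.TensorProduct.includeLeft =
      (Algebra.TensorProduct.includeLeft : L →ₐ[k] L ⊗[k] A) := by
    ext; simp [translationEnd]
  have h3 := AlgHom.comp_convMul_distrib (translationEnd (pointInv χ))
    (toConv ((Algebra.TensorProduct.includeLeft : L →ₐ[k] L ⊗[k] A).comp χ.ofConv))
    (toConv (Algebra.TensorProduct.includeRight : A →ₐ[k] L ⊗[k] A))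
  rw [← toConv_translationAlgHom, ofConv_toConv, ofConv_toConv, ofConv_toConv, h1,
    ← AlgHom.comp_assoc, h2, toConv_translationAlgHom, ← mul_assoc] at h3
  have h4 : toConv ((Algebra.TensorProduct.includeLeft : L →ₐ[k] L ⊗[k] A).comp χ.ofConv) *
      toConv ((Algebra.TensorProduct.includeLeft : L →ₐ[k] L ⊗[k] A).comp (pointInv χ).ofConv) = 1 :=
    mul_pointInv_cancel (toConv ((Algebra.TensorProduct.includeLeft : L →ₐ[k] L ⊗[k] A).comp χ.ofConv))
  rw [h4, one_mul] at h3
  exact DFunLike.congr_fun h3 a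

theorem lift_translationAlgHom_inv (χ : WithConv (A →ₐ[k] L)) (a : A) :
    Algebra.TensorProduct.lift (AlgHom.id k L) χ.ofConv (fun _ _ ↦ .all _ _)
      (translationAlgHom (pointInv χ) a) = algebraMap k L (Coalgebra.counit (R := k) a) := by
  have h2 : (Algebra.TensorProduct.lift (AlgHom.id k L) χ.ofConv (fun _ _ ↦ .all _ _)).comp
      (Algebra.TensorProduct.includeRight : A →ₐ[k] L ⊗[k] A) = χ.ofConv := by
    ext; simp
  have h3 := AlgHom.comp_convMul_distrib
    (Algebra.TensorProduct.lift (AlgHom.id k L) χ.ofConv (fun _ _ ↦ .all _ _))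
    (toConv ((Algebra.TensorProduct.includeLeft : L →ₐ[k] L ⊗[k] A).comp (pointInv χ).ofConv))
    (toConv (Algebra.TensorProduct.includeRight : A →ₐ[k] L ⊗[k] A))
  rw [← toConv_translationAlgHom, ofConv_toConv, ofConv_toConv, ofConv_toConv,
    ← AlgHom.comp_assoc, Algebra.TensorProduct.lift_comp_includeLeft,
    h2, AlgHom.id_comp, toConv_ofConv, toConv_ofConv,
    pointInv_mul_cancel] at h3
  exact DFunLike.congr_fun h3 a

/-- If an element `s` of counit `1` kills the translates by `χ` of the elements of `N`, then the
image under `χ` of the annihilator of `N` generates the unit ideal. -/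
theorem one_mem_map_annihilator (χ : WithConv (A →ₐ[k] L)) (N : Set A) (s : A)
    (hs : Coalgebra.counit (R := k) s = 1)
    (hN : ∀ x ∈ N, (1 : L) ⊗ₜ[k] s * translationAlgHom χ x = 0) :
    (1 : L) ∈ Ideal.map χ.ofConv (Ideal.span N).annihilator := by
  classical
  let b := Module.Basis.ofVectorSpace k L
  have hz (x : A) (hx : x ∈ N) : translationAlgHom (pointInv χ) s * (1 : L) ⊗ₜ[k] x = 0 := by
    simpa [translationEnd_one_tmul, translationEnd_inv_translationAlgHom] using
      congrArg (translationEnd (pointInv χ)) (hN x hx)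
  set z := translationAlgHom (pointInv χ) s with hz_def
  have h1 := lift_translationAlgHom_inv χ s
  rw [hs, map_one, ← hz_def] at h1
  obtain ⟨c, hc⟩ := TensorProduct.eq_repr_basis_left b z
  have hmem (i) : c i ∈ (Ideal.span N).annihilator := by
    rw [Submodule.mem_annihilator_span]
    rintro ⟨x, hx⟩
    have h := hz x hx
    have h' : TensorProduct.equivFinsuppOfBasisLeft (N := A) b (z * (1 : L) ⊗ₜ[k] x) i =
        c i * x := by
      rw [← hc, Finsupp.sum, Finset.sum_mul, map_sum]
      simp +contextual [Finsupp.finsetSum_apply, Finsupp.single_apply]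
    rw [smul_eq_mul, ← h', h]
    simp
  rw [← h1, ← hc, Finsupp.sum, map_sum]
  refine Ideal.sum_mem _ fun i _ ↦ ?_
  simpa using Ideal.mul_mem_left _ _ (Ideal.mem_map_of_mem χ.ofConv (hmem i))

end Translation

theorem IsIdempotentElem.eq_zero_or_eq_one_of_connectedSpace {A : Type*} [CommRing A]
    [ConnectedSpace (PrimeSpectrum A)] {e : A} (he : IsIdempotentElem e) : e = 0 ∨ e = 1 := by
  rcases isClopen_iff.1 (PrimeSpectrum.isClopen_iff.2 ⟨e, he, rfl⟩) with h | h
  · refine .inl (PrimeSpectrum.basicOpen_injOn_isIdempotentElem he .zero ?_)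
    rw [PrimeSpectrum.basicOpen_zero]
    exact SetLike.coe_injective h
  · refine .inr (PrimeSpectrum.basicOpen_injOn_isIdempotentElem he .one ?_)
    rw [PrimeSpectrum.basicOpen_one]
    exact SetLike.coe_injective h

theorem LinearMap.exists_comp_eq_of_ker_le_ker {k U V W : Type*} [Field k] [AddCommGroup U]
    [Module k U] [AddCommGroup V] [Module k V] [AddCommGroup W] [Module k W] (f : U →ₗ[k] V)
    (g : U →ₗ[k] W) (h : LinearMap.ker f ≤ LinearMap.ker g) : ∃ l : V →ₗ[k] W, l ∘ₗ f = g := by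
  obtain ⟨l, hl⟩ := ((LinearMap.ker f).liftQ g h ∘ₗ
    f.quotKerEquivRange.symm.toLinearMap).exists_extend
  refine ⟨l, LinearMap.ext fun x ↦ ?_⟩
  have := DFunLike.congr_fun hl ⟨f x, LinearMap.mem_range_self f x⟩
  simpa [LinearMap.quotKerEquivRange_symm_apply_image] using this

theorem map_convPowAlgHom_comul {k A : Type*} [CommRing k] [CommRing A] [Bialgebra k A]
    [Coalgebra.IsCocomm k A] (n : ℕ) (a : A) :
    TensorProduct.map (convPowAlgHom k A n).toLinearMap (convPowAlgHom k A n).toLinearMap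
      (Coalgebra.comul a) = Coalgebra.comul (R := k) (convPowAlgHom k A n a) := by
  let N : A →ₐc[k] A := (toConv (BialgHom.id k A) ^ n).ofConv
  have hN : convPowAlgHom k A n = (N : A →ₐ[k] A) :=
    (congrArg ofConv (BialgHom.toAlgHom_convPow (toConv (BialgHom.id k A)) n)).symm
  rw [hN]
  exact DFunLike.congr_fun (BialgHom.map_comp_comulAlgHom N) a

theorem BialgHom.comp_convPowAlgHom {k A B : Type*} [CommRing k] [CommRing A] [Bialgebra k A]
    [CommRing B] [Bialgebra k B] (j : B →ₐc[k] A) (n : ℕ) :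
    (j : B →ₐ[k] A).comp (convPowAlgHom k B n) = (convPowAlgHom k A n).comp (j : B →ₐ[k] A) := by
  induction n with
  | zero => ext x; simp [convPowAlgHom, AlgHomClass.commutes j]
  | succ n ih =>
    unfold convPowAlgHom at ih ⊢
    rw [pow_succ, pow_succ, AlgHom.comp_convMul_distrib, AlgHom.convMul_comp_bialgHom_distrib, ih]
    rfl

theorem eq_zero_of_convPowAlgHom_eq_zero {k A B : Type*} [Field k] [CharZero k] [CommRing A]
    [HopfAlgebra k A] [Coalgebra.IsCocomm k A] [ConnectedSpace (PrimeSpectrum A)] [CommRing B]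
    [Bialgebra k B] [IsNoetherianRing B] (j : B →ₐc[k] A) (hj : Function.Injective j) {n : ℕ}
    (hn : n ≠ 0) {y : B} (hy : convPowAlgHom k A n (j y) = 0) : y = 0 := by
  have hcomp (b : B) : j (convPowAlgHom k B n b) = convPowAlgHom k A n (j b) :=
    DFunLike.congr_fun (j.comp_convPowAlgHom n) b
  have hcounit (b : B) : Coalgebra.counit (R := k) (j b) = Coalgebra.counit (R := k) b :=
    DFunLike.congr_fun (BialgHom.counitAlgHom_comp j) b
  obtain ⟨s, hs, hsK⟩ := exists_counit_eq_one_forall_mul_eq_zero (k := k) (B := B) hn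
  let N : Set A := j '' RingHom.ker (convPowAlgHom k B n)
  let χ : WithConv (A →ₐ[k] A ⧸ Ideal.span N) := toConv (Ideal.Quotient.mkₐ k (Ideal.span N))
  let f : B →ₗ[k] A := ((convPowAlgHom k A n).comp (j : B →ₐ[k] A)).toLinearMap
  have hf {b : B} (hb : f b = 0) : b ∈ RingHom.ker (convPowAlgHom k B n) :=
    hj (by rw [map_zero, hcomp]; exact hb)
  obtain ⟨g, hg⟩ := f.exists_comp_eq_of_ker_le_ker
    (χ.ofConv.comp (j : B →ₐ[k] A)).toLinearMap fun b hb ↦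
      Ideal.Quotient.eq_zero_iff_mem.2 (Ideal.subset_span ⟨b, hf hb, rfl⟩)
  obtain ⟨h, hh⟩ := f.exists_comp_eq_of_ker_le_ker
    (LinearMap.mulLeft k (j s) ∘ₗ (j : B →ₐ[k] A).toLinearMap) fun b hb ↦ by
      simpa using congrArg j (hsK b (hf hb))
  have hN : ∀ x ∈ N, (1 : A ⧸ Ideal.span N) ⊗ₜ[k] j s * translationAlgHom χ x = 0 := by
    rintro _ ⟨b, hb, rfl⟩
    have hjb : convPowAlgHom k A n (j b) = 0 := by
      rw [← hcomp, show convPowAlgHom k B n b = 0 from hb, map_zero]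
    have hcomul : Coalgebra.comul (R := k) (j b) =
        TensorProduct.map (j : B →ₐ[k] A).toLinearMap (j : B →ₐ[k] A).toLinearMap
          (Coalgebra.comul b) :=
      (DFunLike.congr_fun (BialgHom.map_comp_comulAlgHom j) b).symm
    have h0 : TensorProduct.map f f (Coalgebra.comul (R := k) b) = 0 := by
      have := map_convPowAlgHom_comul (k := k) n (j b)
      rw [hjb, map_zero, hcomul] at this
      rw [← this, TensorProduct.map_map]
      rfl
    have h1 := congrArg (TensorProduct.map g h) h0
    rw [← LinearMap.comp_apply, ← TensorProduct.map_comp, hg, hh, map_zero] at h1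
    rw [← h1]
    change (1 : A ⧸ Ideal.span N) ⊗ₜ[k] j s *
      Algebra.TensorProduct.map χ.ofConv (AlgHom.id k A) (Coalgebra.comul (R := k) (j b)) = _
    rw [hcomul]
    generalize (Coalgebra.comul (R := k) b) = D
    induction D with
    | zero => simp
    | tmul u v => simp
    | add u v hu hv => simp only [map_add, mul_add, hu, hv]
  have h1 := one_mem_map_annihilator χ N (j s) (by rw [hcounit, hs]) hN
  obtain ⟨t, ht, ht1⟩ :=
    (Ideal.mem_map_iff_of_surjective χ.ofConv (Ideal.Quotient.mkₐ_surjective k _)).1 h1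
  have ht2 : 1 - t ∈ Ideal.span N := by
    rw [← Ideal.Quotient.eq_zero_iff_mem, map_sub, map_one, sub_eq_zero]
    exact ht1.symm
  have htK {x : A} (hx : x ∈ Ideal.span N) : t * x = 0 := Submodule.mem_annihilator.1 ht x hx
  have hidem : IsIdempotentElem t := by
    have := htK ht2
    rw [mul_sub, mul_one, sub_eq_zero] at this
    exact this.symm
  have hyN : j y ∈ Ideal.span N := Ideal.subset_span ⟨y, hf hy, rfl⟩
  rcases hidem.eq_zero_or_eq_one_of_connectedSpace with rfl | rfl
  · have hle : Ideal.span N ≤ RingHom.ker (Bialgebra.counitAlgHom k A) := by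
      rw [Ideal.span_le]
      rintro _ ⟨b, hb, rfl⟩
      have := DFunLike.congr_fun (counitAlgHom_comp_convPowAlgHom (k := k) (B := B) n) b
      have hb' : convPowAlgHom k B n b = 0 := hb
      simp only [AlgHom.comp_apply, hb', map_zero] at this
      exact (hcounit b).trans this.symm
    have := hle ht2
    simp [RingHom.mem_ker] at this
  · exact hj (by simpa using htK hyN)

section Subbialgebra

variable {k A : Type*} [Field k] [CommRing A] [Bialgebra k A] (S : Subalgebra k A)

theorem Subalgebra.map_val_val_injective :
    Function.Injective (Algebra.TensorProduct.map S.val S.val) :=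
  TensorProduct.map_injective_of_flat_flat S.val.toLinearMap S.val.toLinearMap
    Subtype.val_injective Subtype.val_injective

variable (hS : ∀ a ∈ S, Coalgebra.comul (R := k) a ∈ (Algebra.TensorProduct.map S.val S.val).range)

/-- The comultiplication of a subalgebra stable under comultiplication. -/
noncomputable def Subalgebra.comulAlgHom : S →ₐ[k] S ⊗[k] S :=
  (AlgEquiv.ofInjective _ S.map_val_val_injective).symm.toAlgHom.comp
    (((Bialgebra.comulAlgHom k A).comp S.val).codRestrict _ fun a ↦ hS a a.2)

theorem Subalgebra.map_val_comulAlgHom (a : S) :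
    Algebra.TensorProduct.map S.val S.val (S.comulAlgHom hS a) = Coalgebra.comul (R := k) (a : A) :=
  congrArg Subtype.val ((AlgEquiv.ofInjective _ S.map_val_val_injective).apply_symm_apply
    (((Bialgebra.comulAlgHom k A).comp S.val).codRestrict _ (fun a ↦ hS a a.2) a))

/-- The bialgebra structure of a subalgebra stable under comultiplication. -/
noncomputable abbrev Subalgebra.bialgebra : Bialgebra k S :=
  .ofAlgHom (S.comulAlgHom hS) ((Bialgebra.counitAlgHom k A).comp S.val)
    (by
      ext a
      apply TensorProduct.map_injective_of_flat_flat S.val.toLinearMap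
        (TensorProduct.map S.val.toLinearMap S.val.toLinearMap) Subtype.val_injective
        S.map_val_val_injective
      have h := Coalgebra.coassoc_apply (R := k) (a : A)
      rw [← S.map_val_comulAlgHom hS] at h
      convert h using 1
      · simp only [AlgHom.comp_apply]
        generalize S.comulAlgHom hS a = D
        induction D with
        | zero => simp
        | tmul u v =>
          simp [← S.map_val_comulAlgHom hS]
          generalize S.comulAlgHom hS u = E
          induction E with
          | zero => simp
          | tmul u v => simp
          | add u v hu hv => simp only [map_add, TensorProduct.add_tmul, hu, hv]
        | add u v hu hv => simp only [map_add, hu, hv]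
      · simp only [AlgHom.comp_apply]
        generalize S.comulAlgHom hS a = D
        induction D with
        | zero => simp
        | tmul u v =>
          simp [← S.map_val_comulAlgHom hS]
          rfl
        | add u v hu hv => simp only [map_add, hu, hv])
    (by
      ext a
      apply Module.Flat.lTensor_preserves_injective_linearMap (M := k) S.val.toLinearMap
        Subtype.val_injective
      have h := Coalgebra.rTensor_counit_comul (R := k) (a : A)
      rw [← S.map_val_comulAlgHom hS] at h
      convert h using 1
      · simp only [AlgHom.comp_apply]
        generalize S.comulAlgHom hS a = D
        induction D with
        | zero => simp
        | tmul u v => simp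
        | add u v hu hv => simp only [map_add, hu, hv]
      · rfl)
    (by
      ext a
      apply Module.Flat.rTensor_preserves_injective_linearMap (M := k) S.val.toLinearMap
        Subtype.val_injective
      have h := Coalgebra.lTensor_counit_comul (R := k) (a : A)
      rw [← S.map_val_comulAlgHom hS] at h
      convert h using 1
      · simp only [AlgHom.comp_apply]
        generalize S.comulAlgHom hS a = D
        induction D with
        | zero => simp
        | tmul u v => simp
        | add u v hu hv => simp only [map_add, hu, hv]
      · rfl)

/-- The inclusion of a subalgebra stable under comultiplication, as a bialgebra homomorphism. -/
noncomputable def Subalgebra.valBialgHom :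
    letI := S.bialgebra hS
    S →ₐc[k] A :=
  letI := S.bialgebra hS
  .ofAlgHom S.val rfl (AlgHom.ext fun a ↦ S.map_val_comulAlgHom hS a)

end Subbialgebra

/-- Every element of a cocommutative coalgebra over a field lies in a finite-dimensional
subcoalgebra. -/
theorem exists_finset_comul_mem_range {k A : Type*} [Field k] [AddCommGroup A] [Module k A]
    [Coalgebra k A] [Coalgebra.IsCocomm k A] (x : A) :
    ∃ s : Finset A, x ∈ Submodule.span k (s : Set A) ∧ ∀ v ∈ s, Coalgebra.comul (R := k) v ∈
      LinearMap.range (TensorProduct.map (Submodule.span k (s : Set A)).subtype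
        (Submodule.span k (s : Set A)).subtype) := by
  classical
  let b := Module.Basis.ofVectorSpace k A
  obtain ⟨c, hc⟩ := TensorProduct.eq_repr_basis_left b (Coalgebra.comul (R := k) x)
  let s := c.support.image c
  let V := Submodule.span k (s : Set A)
  obtain ⟨p, hp⟩ := V.subtype.exists_leftInverse_of_injective V.ker_subtype
  let q : A →ₗ[k] A := V.subtype ∘ₗ p
  have hq {v : A} (hv : v ∈ V) : q v = v :=
    congrArg Subtype.val (DFunLike.congr_fun hp (⟨v, hv⟩ : V))
  have hcV {i} (hi : i ∈ c.support) : c i ∈ V :=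
    Submodule.subset_span (Finset.mem_coe.2 (Finset.mem_image_of_mem c hi))
  have hx : q.lTensor A (Coalgebra.comul (R := k) x) = Coalgebra.comul (R := k) x := by
    rw [← hc, Finsupp.sum, map_sum]
    exact Finset.sum_congr rfl fun i hi ↦ by rw [LinearMap.lTensor_tmul, hq (hcV hi)]
  refine ⟨s, ?_, fun v hv ↦ ?_⟩
  · have h := Coalgebra.rTensor_counit_comul (R := k) x
    rw [← hc, Finsupp.sum, map_sum] at h
    have h' := congrArg (TensorProduct.lid k A) h
    simp only [map_sum, LinearMap.rTensor_tmul, TensorProduct.lid_tmul, one_smul] at h'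
    rw [← h']
    exact Submodule.sum_mem _ fun i hi ↦ Submodule.smul_mem _ _ (hcV hi)
  · obtain ⟨i, hi, rfl⟩ := Finset.mem_image.1 hv
    have hci : c i = TensorProduct.lid k A ((b.coord i).rTensor A (Coalgebra.comul (R := k) x)) := by
      rw [← TensorProduct.equivFinsuppOfBasisLeft_apply, ← hc,
        ← TensorProduct.equivFinsuppOfBasisLeft_symm_apply, LinearEquiv.apply_symm_apply]
    have hcomul : Coalgebra.comul (R := k) (c i) = TensorProduct.lid k (A ⊗[k] A)
        ((b.coord i).rTensor (A ⊗[k] A)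
          (TensorProduct.assoc k A A A (Coalgebra.comul.rTensor A (Coalgebra.comul (R := k) x)))) := by
      rw [Coalgebra.coassoc_apply, hci]
      generalize Coalgebra.comul (R := k) x = D
      induction D with
      | zero => simp
      | tmul u v => simp
      | add u v hu hv => simp only [map_add, hu, hv]
    have hl : q.lTensor A (Coalgebra.comul (R := k) (c i)) = Coalgebra.comul (R := k) (c i) := by
      have key (D : A ⊗[k] A) : q.lTensor A (TensorProduct.lid k (A ⊗[k] A)
          ((b.coord i).rTensor (A ⊗[k] A)
            (TensorProduct.assoc k A A A (Coalgebra.comul.rTensor A D)))) =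
          TensorProduct.lid k (A ⊗[k] A) ((b.coord i).rTensor (A ⊗[k] A)
            (TensorProduct.assoc k A A A (Coalgebra.comul.rTensor A (q.lTensor A D)))) := by
        induction D with
        | zero => simp
        | tmul u v =>
          simp only [LinearMap.rTensor_tmul, LinearMap.lTensor_tmul]
          generalize Coalgebra.comul (R := k) u = E
          induction E with
          | zero => simp
          | tmul u v => simp
          | add u v hu hv => simp only [map_add, TensorProduct.add_tmul, hu, hv]
        | add u v hu hv => simp only [map_add, hu, hv]
      rw [hcomul, key, hx]
    have hr : q.rTensor A (Coalgebra.comul (R := k) (c i)) = Coalgebra.comul (R := k) (c i) := by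
      have key (D : A ⊗[k] A) : q.rTensor A (TensorProduct.comm k A A D) =
          TensorProduct.comm k A A (q.lTensor A D) := by
        induction D with
        | zero => simp
        | tmul u v => simp
        | add u v hu hv => simp only [map_add, hu, hv]
      have h := key (Coalgebra.comul (R := k) (c i))
      rwa [hl, Coalgebra.comm_comul] at h
    refine ⟨TensorProduct.map p p (Coalgebra.comul (R := k) (c i)), ?_⟩
    rw [TensorProduct.map_map]
    conv_rhs => rw [← hr, ← hl]
    exact (DFunLike.congr_fun (LinearMap.rTensor_comp_lTensor _ q q) _).symm

/-- Every element of a cocommutative bialgebra over a field lies in a finitely generated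
subbialgebra. -/
theorem exists_fg_subalgebra_comul_mem_range {k A : Type*} [Field k] [CommRing A] [Bialgebra k A]
    [Coalgebra.IsCocomm k A] (x : A) :
    ∃ S : Subalgebra k A, S.FG ∧ x ∈ S ∧
      ∀ a ∈ S, Coalgebra.comul (R := k) a ∈ (Algebra.TensorProduct.map S.val S.val).range := by
  obtain ⟨s, hx, hs⟩ := exists_finset_comul_mem_range (k := k) x
  have hle : Submodule.span k (s : Set A) ≤
      Subalgebra.toSubmodule (Algebra.adjoin k (s : Set A)) :=
    Algebra.span_le_adjoin k _
  refine ⟨Algebra.adjoin k s, ⟨s, rfl⟩, hle hx, fun a ha ↦ ?_⟩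
  suffices h : Algebra.adjoin k (s : Set A) ≤ ((Algebra.TensorProduct.map
      (Algebra.adjoin k (s : Set A)).val (Algebra.adjoin k (s : Set A)).val).range.comap
        (Bialgebra.comulAlgHom k A)) from h ha
  refine Algebra.adjoin_le fun v hv ↦ ?_
  obtain ⟨D, hD⟩ := hs v hv
  refine ⟨TensorProduct.map (Submodule.inclusion hle) (Submodule.inclusion hle) D, ?_⟩
  refine Eq.trans ?_ hD
  exact TensorProduct.map_map _ _ _ _ _

/-- Let `k` be a field of characteristic `0` and `A` a commutative, cocommutative Hopf
algebra over `k` which is reduced and has connected prime spectrum.  Then for every `n > 0`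
the `n`-th convolution power of the identity `[n] : A → A` is injective. -/
theorem convPowId_injective (k A : Type*) [Field k] [CharZero k] [CommRing A]
    [HopfAlgebra k A]
    (hcocomm : (TensorProduct.comm k A A).toLinearMap ∘ₗ
        (Coalgebra.comul (R := k) (A := A)) = Coalgebra.comul)
    (hred : IsReduced A) (hconn : ConnectedSpace (PrimeSpectrum A)) :
    ∀ n : ℕ, 0 < n → Function.Injective (convPowId k A n) := by
  intro n hn
  have : Coalgebra.IsCocomm k A := ⟨hcocomm⟩
  have heq : convPowId k A n = (convPowAlgHom k A n).toLinearMap := by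
    clear hn
    induction n with
    | zero => rfl
    | succ n ih =>
      rw [convPowId, ih]
      rfl
  rw [heq, ← LinearMap.ker_eq_bot, LinearMap.ker_eq_bot']
  intro x hx
  obtain ⟨S, hfg, hxS, hS⟩ := exists_fg_subalgebra_comul_mem_range (k := k) x
  let := S.bialgebra hS
  have : IsNoetherianRing S := Algebra.FiniteType.isNoetherianRing (R := k) S
    (h := S.fg_iff_finiteType.1 hfg)
  exact congrArg Subtype.val (eq_zero_of_convPowAlgHom_eq_zero (S.valBialgHom hS)
    Subtype.val_injective hn.ne' (y := ⟨x, hxS⟩) hx)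
end
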